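/- arXiv:2409.07317 — 2 statements merged into one kernel-verified Lean document; each statement's English description precedes it below -/
import Mathlib

section
/- (Structure of the untwisted affine Weyl group.) Let Ŵ be the subgroup of O(F̂, Î) generated by the reflections ŝ_{α + nδ} for all α ∈ R_f and n ∈ ℤ. Then Ŵ = { u ∘ t_γ : u ∈ W(R_f), γ ∈ Q(R_f^∨) } (with u extended to F̂ fixing δ and Λ_0), and the map (u, γ) ↦ u ∘ t_γ is a group isomorphism from the semidirect product W(R_f) ⋉ Q(R_f^∨) onto Ŵ. -/
open scoped BigOperators Classical

/-- A reduced irreducible finite root system spanning a real vector space `V`,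
equipped with a positive definite symmetric bilinear form `I`. -/
structure RootSys (V : Type) [AddCommGroup V] [Module ℝ V] where
  I : V →ₗ[ℝ] V →ₗ[ℝ] ℝ
  symm : ∀ x y : V, I x y = I y x
  posdef : ∀ x : V, x ≠ 0 → 0 < I x x
  R : Finset V
  zero_notmem : (0 : V) ∉ R
  spanning : Submodule.span ℝ (R : Set V) = ⊤
  reduced : ∀ α ∈ R, ∀ c : ℝ, c • α ∈ R → c = 1 ∨ c = -1
  integral : ∀ α ∈ R, ∀ β ∈ R, ∃ n : ℤ, I ((2 / I α α) • α) β = (n : ℝ)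
  reflect : ∀ α ∈ R, ∀ β ∈ R, β - (I ((2 / I α α) • α) β) • α ∈ R
  irred : ∀ R₁ R₂ : Finset V, R₁ ∪ R₂ = R →
    (∀ α ∈ R₁, ∀ β ∈ R₂, I α β = 0) → R₁ = ∅ ∨ R₂ = ∅

/-- The Weyl group of `R_f`: the subgroup of linear automorphisms generated by the
reflections `s_α(λ) = λ − I(λ,α^∨)α`, `α ∈ R_f`. -/
noncomputable def Weyl {V : Type} [AddCommGroup V] [Module ℝ V] (S : RootSys V) :
    Subgroup (V ≃ₗ[ℝ] V) :=
  Subgroup.closure {u | ∃ α ∈ S.R, ∀ x : V, u x = x - (2 * S.I α x / S.I α α) • α}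

/-- The extended space `F̂ = F_f ⊕ ℝδ ⊕ ℝΛ₀`. -/
abbrev HatV (V : Type) := V × ℝ × ℝ

/-- The null vector `δ`. -/
def deltaH {V : Type} [AddCommGroup V] : HatV V := (0, 1, 0)

/-- The null vector `Λ₀`. -/
def lamH {V : Type} [AddCommGroup V] : HatV V := (0, 0, 1)

/-- The embedding `F_f → F̂`. -/
def embH {V : Type} [AddCommGroup V] (x : V) : HatV V := (x, 0, 0)

/-- The symmetric bilinear form `Î` on `F̂` extending `I`, with
`Î(δ, F_f) = Î(Λ₀, F_f) = 0`, `Î(δ,δ) = Î(Λ₀,Λ₀) = 0`, `Î(δ,Λ₀) = 1`. -/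
noncomputable def hatI {V : Type} [AddCommGroup V] [Module ℝ V]
    (I : V →ₗ[ℝ] V →ₗ[ℝ] ℝ) (p q : HatV V) : ℝ :=
  I p.1 q.1 + p.2.1 * q.2.2 + p.2.2 * q.2.1

/-- The translation `t_γ(λ) = λ + Î(λ,δ)γ − (Î(λ,γ) + (1/2)Î(γ,γ)Î(λ,δ))δ` for `γ ∈ F_f`. -/
noncomputable def tH {V : Type} [AddCommGroup V] [Module ℝ V]
    (I : V →ₗ[ℝ] V →ₗ[ℝ] ℝ) (γ : V) (p : HatV V) : HatV V :=
  p + (hatI I p deltaH) • embH γ -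
    (hatI I p (embH γ) + (1 / 2) * hatI I (embH γ) (embH γ) * hatI I p deltaH) • deltaH

/-- The extension of `u : F_f → F_f` to `F̂`, acting as `u` on `F_f` and fixing `δ` and `Λ₀`. -/
def uHat {V : Type} [AddCommGroup V] [Module ℝ V] (u : V ≃ₗ[ℝ] V) (p : HatV V) : HatV V :=
  (u p.1, p.2.1, p.2.2)

/-- The reflection `ŝ_v(λ) = λ − Î(λ, v^∨)v` on `F̂`, where `v^∨ = 2v/Î(v,v)`. -/
noncomputable def sH {V : Type} [AddCommGroup V] [Module ℝ V]
    (I : V →ₗ[ℝ] V →ₗ[ℝ] ℝ) (v : HatV V) (p : HatV V) : HatV V :=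
  p - (hatI I p ((2 / hatI I v v) • v)) • v

/-- The coroot lattice `Q(R^∨)`, generated by the coroots `α^∨ = (2/I(α,α))•α`. -/
noncomputable def corootLat {V : Type} [AddCommGroup V] [Module ℝ V] (S : RootSys V) :
    AddSubgroup V := AddSubgroup.closure {x : V | ∃ α ∈ S.R, x = (2 / S.I α α) • α}

/-- The untwisted affine Weyl group: the subgroup of `O(F̂, Î)` generated by the
reflections `ŝ_{α+nδ}` for `α ∈ R_f`, `n ∈ ℤ`. -/
noncomputable def affWeyl {V : Type} [AddCommGroup V] [Module ℝ V] (S : RootSys V) :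
    Subgroup (HatV V ≃ₗ[ℝ] HatV V) :=
  Subgroup.closure
    {e | ∃ α ∈ S.R, ∃ n : ℤ, ∀ p : HatV V, e p = sH S.I (embH α + (n : ℝ) • deltaH) p}

section AffineWeyl

variable {V : Type} [AddCommGroup V] [Module ℝ V]

lemma tH_eq (I : V →ₗ[ℝ] V →ₗ[ℝ] ℝ) (γ : V) (p : HatV V) :
    tH I γ p = (p.1 + p.2.2 • γ, p.2.1 - I p.1 γ - 1 / 2 * I γ γ * p.2.2, p.2.2) := by
  refine Prod.ext ?_ (Prod.ext ?_ ?_)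
  · simp [tH, hatI, deltaH, embH]
  · simp [tH, hatI, deltaH, embH]
    ring
  · simp [tH, hatI, deltaH, embH]

lemma tH_add {I : V →ₗ[ℝ] V →ₗ[ℝ] ℝ} (hI : ∀ x y, I x y = I y x) (γ₁ γ₂ : V) (p : HatV V) :
    tH I γ₁ (tH I γ₂ p) = tH I (γ₁ + γ₂) p := by
  simp only [tH_eq]
  refine Prod.ext ?_ (Prod.ext ?_ rfl)
  · simp only [smul_add]
    abel
  · simp only [map_add, map_smul, LinearMap.add_apply, LinearMap.smul_apply, smul_eq_mul, hI γ₂ γ₁]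
    ring

lemma tH_zero (I : V →ₗ[ℝ] V →ₗ[ℝ] ℝ) (p : HatV V) : tH I 0 p = p := by
  simp [tH_eq]

/-- The translation `t_γ` as a linear automorphism of `F̂`. -/
noncomputable def tHEquiv (S : RootSys V) (γ : V) : HatV V ≃ₗ[ℝ] HatV V where
  toFun := tH S.I γ
  invFun := tH S.I (-γ)
  map_add' p q := by
    simp only [tH_eq]
    refine Prod.ext ?_ (Prod.ext ?_ rfl)
    · simp only [Prod.fst_add, Prod.snd_add, add_smul]
      abel
    · simp only [Prod.fst_add, Prod.snd_add, map_add, LinearMap.add_apply]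
      ring
  map_smul' c p := by
    simp only [tH_eq]
    refine Prod.ext ?_ (Prod.ext ?_ rfl)
    · simp [mul_smul]
    · simp
      ring
  left_inv p := by rw [tH_add S.symm, neg_add_cancel, tH_zero]
  right_inv p := by rw [tH_add S.symm, add_neg_cancel, tH_zero]

/-- The extension to `F̂` of linear automorphisms of `F_f`, as a group homomorphism. -/
def uHatHom (V : Type) [AddCommGroup V] [Module ℝ V] :
    (V ≃ₗ[ℝ] V) →* (HatV V ≃ₗ[ℝ] HatV V) where
  toFun u := u.prodCongr (LinearEquiv.refl ℝ (ℝ × ℝ))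
  map_one' := rfl
  map_mul' _ _ := rfl

lemma uHat_tH {I : V →ₗ[ℝ] V →ₗ[ℝ] ℝ} {u : V ≃ₗ[ℝ] V} (hu : ∀ x y, I (u x) (u y) = I x y)
    (γ : V) (p : HatV V) : tH I γ (uHat u p) = uHat u (tH I (u⁻¹ γ) p) := by
  obtain ⟨γ, rfl⟩ := u.surjective γ
  have h : u⁻¹ (u γ) = γ := u.symm_apply_apply γ
  simp [h, tH_eq, uHat, hu]

namespace RootSys

variable (S : RootSys V)

lemma I_self_ne_zero {α : V} (hα : α ∈ S.R) : S.I α α ≠ 0 :=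
  (S.posdef α fun h => S.zero_notmem (h ▸ hα)).ne'

/-- The reflection in a root. -/
noncomputable def reflection {α : V} (hα : α ∈ S.R) : V ≃ₗ[ℝ] V :=
  LinearEquiv.ofInvolutive
    (LinearMap.id - ((2 / S.I α α) • S.I α).smulRight α) fun x => by
      have h := S.I_self_ne_zero hα
      simp only [LinearMap.sub_apply, LinearMap.id_apply, LinearMap.smulRight_apply,
        LinearMap.smul_apply, map_sub, map_smul, smul_eq_mul]
      match_scalars <;> field_simp
      ring

lemma reflection_apply {α : V} (hα : α ∈ S.R) (x : V) :
    S.reflection hα x = x - (2 * S.I α x / S.I α α) • α := by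
  change x - (2 / S.I α α * S.I α x) • α = _
  rw [div_mul_eq_mul_div]

lemma reflection_mem_Weyl {α : V} (hα : α ∈ S.R) : S.reflection hα ∈ Weyl S :=
  Subgroup.subset_closure ⟨α, hα, S.reflection_apply hα⟩

lemma exists_eq_reflection {u : V ≃ₗ[ℝ] V}
    (hu : ∃ α ∈ S.R, ∀ x : V, u x = x - (2 * S.I α x / S.I α α) • α) :
    ∃ (α : V) (hα : α ∈ S.R), u = S.reflection hα := by
  obtain ⟨α, hα, h⟩ := hu
  exact ⟨α, hα, LinearEquiv.ext fun x => (h x).trans (S.reflection_apply hα x).symm⟩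

lemma I_Weyl {u : V ≃ₗ[ℝ] V} (hu : u ∈ Weyl S) : ∀ x y, S.I (u x) (u y) = S.I x y := by
  induction hu using Subgroup.closure_induction with
  | mem u hu =>
    obtain ⟨α, hα, rfl⟩ := S.exists_eq_reflection hu
    intro x y
    have h := S.I_self_ne_zero hα
    simp only [reflection_apply, map_sub, map_smul, LinearMap.sub_apply, LinearMap.smul_apply,
      smul_eq_mul, S.symm x α]
    field_simp
    ring
  | one => exact fun _ _ => rfl
  | mul u v _ _ hu hv => exact fun x y => (hu _ _).trans (hv x y)
  | inv u _ hu =>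
    intro x y
    rw [← hu, ← LinearEquiv.mul_apply, ← LinearEquiv.mul_apply, mul_inv_cancel]
    rfl

lemma I_root_corootLat {α γ : V} (hα : α ∈ S.R) (hγ : γ ∈ corootLat S) :
    ∃ n : ℤ, S.I α γ = n := by
  induction hγ using AddSubgroup.closure_induction with
  | mem γ hγ =>
    obtain ⟨β, hβ, rfl⟩ := hγ
    rw [S.symm]
    exact S.integral β hβ α hα
  | zero => exact ⟨0, by simp⟩
  | add x y _ _ hx hy =>
    obtain ⟨m, hm⟩ := hx
    obtain ⟨n, hn⟩ := hy
    exact ⟨m + n, by simp [hm, hn]⟩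
  | neg x _ hx =>
    obtain ⟨m, hm⟩ := hx
    exact ⟨-m, by simp [hm]⟩

lemma coroot_mem_corootLat {α : V} (hα : α ∈ S.R) : (2 / S.I α α) • α ∈ corootLat S :=
  AddSubgroup.subset_closure ⟨α, hα, rfl⟩

lemma reflection_mem_corootLat {α γ : V} (hα : α ∈ S.R) (hγ : γ ∈ corootLat S) :
    S.reflection hα γ ∈ corootLat S := by
  obtain ⟨n, hn⟩ := S.I_root_corootLat hα hγ
  have h : S.reflection hα γ = γ - n • ((2 / S.I α α) • α) := by
    rw [reflection_apply, hn, ← Int.cast_smul_eq_zsmul ℝ, smul_smul]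
    congr 2
    ring
  rw [h]
  exact sub_mem hγ (zsmul_mem (S.coroot_mem_corootLat hα) n)

lemma reflection_reflection {α : V} (hα : α ∈ S.R) (x : V) :
    S.reflection hα (S.reflection hα x) = x :=
  (S.reflection hα).left_inv x

lemma Weyl_mem_corootLat_iff {u : V ≃ₗ[ℝ] V} (hu : u ∈ Weyl S) :
    ∀ γ, u γ ∈ corootLat S ↔ γ ∈ corootLat S := by
  induction hu using Subgroup.closure_induction with
  | mem u hu =>
    obtain ⟨α, hα, rfl⟩ := S.exists_eq_reflection hu
    refine fun γ => ⟨fun h => ?_, S.reflection_mem_corootLat hα⟩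
    simpa only [reflection_reflection] using S.reflection_mem_corootLat hα h
  | one => exact fun _ => Iff.rfl
  | mul u v _ _ hu hv => exact fun γ => (hu _).trans (hv γ)
  | inv u _ hu =>
    intro γ
    rw [← hu, ← LinearEquiv.mul_apply, mul_inv_cancel]
    rfl

/-- The affine reflection `ŝ_{α + nδ}` is `s_α ∘ t_{nα^∨}`. -/
lemma sH_eq {α : V} (hα : α ∈ S.R) (n : ℝ) (p : HatV V) :
    sH S.I (embH α + n • deltaH) p =
      uHat (S.reflection hα) (tH S.I (n • (2 / S.I α α) • α) p) := by
  have h := S.I_self_ne_zero hα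
  have hv : hatI S.I (embH α + n • deltaH) (embH α + n • deltaH) = S.I α α := by
    simp [hatI, embH, deltaH]
  rw [sH, hv, tH_eq]
  refine Prod.ext ?_ (Prod.ext ?_ ?_)
  · simp only [hatI, embH, deltaH, uHat, reflection_apply, Prod.fst_sub, Prod.fst_add,
      Prod.snd_add, Prod.smul_fst, Prod.smul_snd, map_add, map_smul, smul_eq_mul, S.symm p.1 α,
      smul_zero, add_zero, zero_add]
    match_scalars <;> field_simp
    ring
  · simp [hatI, embH, deltaH, uHat]
    field_simp
    ring
  · simp [hatI, embH, deltaH, uHat]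

lemma uHat_tH_comp {u₁ u₂ : V ≃ₗ[ℝ] V} (hu₂ : u₂ ∈ Weyl S) (γ₁ γ₂ : V) (p : HatV V) :
    uHat u₁ (tH S.I γ₁ (uHat u₂ (tH S.I γ₂ p))) =
      uHat (u₁ * u₂) (tH S.I (u₂⁻¹ γ₁ + γ₂) p) := by
  rw [uHat_tH (S.I_Weyl hu₂), tH_add S.symm]
  rfl

lemma uHatHom_mem_affWeyl {u : V ≃ₗ[ℝ] V} (hu : u ∈ Weyl S) : uHatHom V u ∈ affWeyl S := by
  suffices h : Weyl S ≤ (affWeyl S).comap (uHatHom V) from h hu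
  refine (Subgroup.closure_le _).2 fun u hu => ?_
  obtain ⟨α, hα, rfl⟩ := S.exists_eq_reflection hu
  refine Subgroup.subset_closure ⟨α, hα, 0, fun p => ?_⟩
  rw [S.sH_eq hα, Int.cast_zero, zero_smul, tH_zero]
  rfl

lemma tHEquiv_mul (γ₁ γ₂ : V) : tHEquiv S γ₁ * tHEquiv S γ₂ = tHEquiv S (γ₁ + γ₂) :=
  LinearEquiv.ext (tH_add S.symm γ₁ γ₂)

lemma tHEquiv_mem_affWeyl {γ : V} (hγ : γ ∈ corootLat S) : tHEquiv S γ ∈ affWeyl S := by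
  have h_zero : tHEquiv S 0 = 1 := LinearEquiv.ext (tH_zero S.I)
  induction hγ using AddSubgroup.closure_induction with
  | mem γ hγ =>
    obtain ⟨α, hα, rfl⟩ := hγ
    have h : uHatHom V (S.reflection hα) * tHEquiv S ((2 / S.I α α) • α) ∈ affWeyl S := by
      refine Subgroup.subset_closure ⟨α, hα, 1, fun p => ?_⟩
      rw [S.sH_eq hα, Int.cast_one, one_smul]
      rfl
    exact (Subgroup.mul_mem_cancel_left _
      (S.uHatHom_mem_affWeyl (S.reflection_mem_Weyl hα))).1 h
  | zero => exact h_zero ▸ one_mem _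
  | add x y _ _ hx hy => exact S.tHEquiv_mul x y ▸ mul_mem hx hy
  | neg x _ hx =>
    have h : tHEquiv S (-x) = (tHEquiv S x)⁻¹ :=
      eq_inv_of_mul_eq_one_left (by rw [tHEquiv_mul, neg_add_cancel, h_zero])
    exact h ▸ inv_mem hx

lemma mem_affWeyl_iff (e : HatV V ≃ₗ[ℝ] HatV V) :
    e ∈ affWeyl S ↔
      ∃ u ∈ Weyl S, ∃ γ ∈ corootLat S, ∀ p : HatV V, e p = uHat u (tH S.I γ p) := by
  constructor
  · intro he
    induction he using Subgroup.closure_induction with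
    | mem e he =>
      obtain ⟨α, hα, n, he⟩ := he
      refine ⟨S.reflection hα, S.reflection_mem_Weyl hα, n • (2 / S.I α α) • α,
        zsmul_mem (S.coroot_mem_corootLat hα) n, fun p => ?_⟩
      rw [he, S.sH_eq hα, Int.cast_smul_eq_zsmul]
    | one => exact ⟨1, one_mem _, 0, zero_mem _, fun p => by rw [tH_zero]; rfl⟩
    | mul e₁ e₂ _ _ h₁ h₂ =>
      obtain ⟨u₁, hu₁, γ₁, hγ₁, h₁⟩ := h₁
      obtain ⟨u₂, hu₂, γ₂, hγ₂, h₂⟩ := h₂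
      refine ⟨u₁ * u₂, mul_mem hu₁ hu₂, u₂⁻¹ γ₁ + γ₂,
        add_mem ((S.Weyl_mem_corootLat_iff (inv_mem hu₂) _).2 hγ₁) hγ₂, fun p => ?_⟩
      rw [LinearEquiv.mul_apply, h₁, h₂, S.uHat_tH_comp hu₂]
    | inv e _ he =>
      obtain ⟨u, hu, γ, hγ, he⟩ := he
      refine ⟨u⁻¹, inv_mem hu, u (-γ), (S.Weyl_mem_corootLat_iff hu _).2 (neg_mem hγ),
        fun p => e.injective ?_⟩
      have h : u⁻¹⁻¹ γ + u (-γ) = 0 := by rw [inv_inv, map_neg, add_neg_cancel]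
      rw [he (uHat _ _), S.uHat_tH_comp (inv_mem hu), h, tH_zero, mul_inv_cancel]
      exact e.apply_symm_apply p
  · rintro ⟨u, hu, γ, hγ, he⟩
    have h : e = uHatHom V u * tHEquiv S γ := LinearEquiv.ext he
    exact h ▸ mul_mem (S.uHatHom_mem_affWeyl hu) (S.tHEquiv_mem_affWeyl hγ)

end RootSys

lemma uHat_tH_injective {I : V →ₗ[ℝ] V →ₗ[ℝ] ℝ} {u₁ u₂ : V ≃ₗ[ℝ] V} {γ₁ γ₂ : V}
    (h : ∀ p : HatV V, uHat u₁ (tH I γ₁ p) = uHat u₂ (tH I γ₂ p)) : u₁ = u₂ ∧ γ₁ = γ₂ := by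
  simp only [tH_eq, uHat] at h
  have hu : u₁ = u₂ := LinearEquiv.ext fun x => by
    simpa [embH] using congrArg Prod.fst (h (embH x))
  subst hu
  exact ⟨rfl, u₁.injective (by simpa [lamH] using congrArg Prod.fst (h lamH))⟩

end AffineWeyl

/-- **Structure of the untwisted affine Weyl group:**
`Ŵ = { u ∘ t_γ : u ∈ W(R_f), γ ∈ Q(R_f^∨) }`, and `(u,γ) ↦ u ∘ t_γ` is a group
isomorphism from the semidirect product `W(R_f) ⋉ Q(R_f^∨)` onto `Ŵ`. -/
theorem affine_weyl_structure_untwisted (V : Type) [AddCommGroup V] [Module ℝ V]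
    [FiniteDimensional ℝ V] (S : RootSys V) :
    -- Ŵ is exactly the set of elements u ∘ t_γ
    (∀ e : HatV V ≃ₗ[ℝ] HatV V, e ∈ affWeyl S ↔
      ∃ u ∈ Weyl S, ∃ γ ∈ corootLat S, ∀ p : HatV V, e p = uHat u (tH S.I γ p)) ∧
    -- the map (u, γ) ↦ u ∘ t_γ is injective
    (∀ u₁ ∈ Weyl S, ∀ u₂ ∈ Weyl S, ∀ γ₁ ∈ corootLat S, ∀ γ₂ ∈ corootLat S,
      (∀ p : HatV V, uHat u₁ (tH S.I γ₁ p) = uHat u₂ (tH S.I γ₂ p)) →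
        u₁ = u₂ ∧ γ₁ = γ₂) ∧
    -- and it is a homomorphism from the semidirect product:
    -- (u₁ t_{γ₁})(u₂ t_{γ₂}) = (u₁u₂) t_{u₂⁻¹γ₁ + γ₂}
    (∀ u₁ ∈ Weyl S, ∀ u₂ ∈ Weyl S, ∀ γ₁ γ₂ : V,
      (uHat u₁ ∘ tH S.I γ₁) ∘ (uHat u₂ ∘ tH S.I γ₂) =
        uHat (u₁ * u₂) ∘ tH S.I (u₂⁻¹ γ₁ + γ₂)) := by
  exact ⟨S.mem_affWeyl_iff, fun _ _ _ _ _ _ _ _ h => uHat_tH_injective h,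
    fun _ _ _ hu₂ γ₁ γ₂ => funext (S.uHat_tH_comp hu₂ γ₁ γ₂)⟩
end

section
/- (Product of two affine reflections is a translation.) For every non-isotropic vector α ∈ F_f (viewed in F̂), the vector δ − α is non-isotropic with Î(δ − α, δ − α) = Î(α, α), and ŝ_{δ − α} ∘ ŝ_α = t_{α^∨}, where α^∨ = 2α/Î(α,α). -/
open scoped BigOperators Classical

/-- **Product of two affine reflections is a translation:**
`Î(δ−α, δ−α) = Î(α,α) ≠ 0` and `ŝ_{δ−α} ∘ ŝ_α = t_{α^∨}`. -/
theorem reflections_product_translation (V : Type) [AddCommGroup V] [Module ℝ V]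
    (I : V →ₗ[ℝ] V →ₗ[ℝ] ℝ)
    (hsymm : ∀ x y : V, I x y = I y x)
    (hposdef : ∀ x : V, x ≠ 0 → 0 < I x x) :
    ∀ α : V, I α α ≠ 0 →
      hatI I (deltaH - embH α) (deltaH - embH α) = hatI I (embH α) (embH α) ∧
      hatI I (deltaH - embH α) (deltaH - embH α) ≠ 0 ∧
      sH I (deltaH - embH α) ∘ sH I (embH α) = tH I ((2 / I α α) • α) := by
  intro α hα
  have hnorm : hatI I (deltaH - embH α) (deltaH - embH α) = I α α := by
    simp [hatI, deltaH, embH]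
  have hnorm' : hatI I (embH α) (embH α) = I α α := by
    simp [hatI, embH]
  refine ⟨hnorm.trans hnorm'.symm, hnorm.trans_ne hα, ?_⟩
  funext ⟨x, a, b⟩
  simp only [Function.comp_apply, sH, tH, hnorm, hnorm']
  ext
  · simp [hatI, deltaH, embH]
    match_scalars <;> field_simp <;> ring
  · simp [hatI, deltaH, embH]
    field_simp
    ring
  · simp [hatI, deltaH, embH]
end
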